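/- arXiv:1808.08513 — 2 statements merged into one kernel-verified Lean document; each statement's English description precedes it below -/
import Mathlib

section
/- In a differential category, for the monoidal unit R (using the strictness identifications !R ⊗ R = !R and R ⊗ R = R, so that d°_R, d_R : !R → !R) the following equalities hold: K_R d°_R = d°_R J_R, d_R K_R = J_R d_R, and d_R d°_R = J_R. -/
universe u v

/-- A symmetric strict monoidal category (data and the coherence axioms that
do not require transport along object equalities). Composition `comp f g`
is in diagrammatic order: first `f`, then `g`. -/
structure SMCData where
  Obj : Type u
  Hom : Obj → Obj → Type v
  id : ∀ A : Obj, Hom A A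
  comp : ∀ {A B C : Obj}, Hom A B → Hom B C → Hom A C
  id_comp : ∀ {A B : Obj} (f : Hom A B), comp (id A) f = f
  comp_id : ∀ {A B : Obj} (f : Hom A B), comp f (id B) = f
  comp_assoc : ∀ {A B C D : Obj} (f : Hom A B) (g : Hom B C) (h : Hom C D),
    comp (comp f g) h = comp f (comp g h)
  ten : Obj → Obj → Obj
  unit : Obj
  tHom : ∀ {A B C D : Obj}, Hom A C → Hom B D → Hom (ten A B) (ten C D)
  tHom_id : ∀ (A B : Obj), tHom (id A) (id B) = id (ten A B)
  tHom_comp : ∀ {A₁ A₂ A₃ B₁ B₂ B₃ : Obj} (f : Hom A₁ A₂) (g : Hom A₂ A₃)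
    (f' : Hom B₁ B₂) (g' : Hom B₂ B₃),
    tHom (comp f g) (comp f' g') = comp (tHom f f') (tHom g g')
  tenAssoc : ∀ (A B C : Obj), ten (ten A B) C = ten A (ten B C)
  unit_ten : ∀ (A : Obj), ten unit A = A
  ten_unit : ∀ (A : Obj), ten A unit = A
  sw : ∀ (A B : Obj), Hom (ten A B) (ten B A)
  sw_natural : ∀ {A B C D : Obj} (f : Hom A C) (g : Hom B D),
    comp (tHom f g) (sw C D) = comp (sw A B) (tHom g f)
  sw_sw : ∀ (A B : Obj), comp (sw A B) (sw B A) = id (ten A B)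

/-- The identity morphism transported along an equality of objects. In a
strict monoidal category the structural isomorphisms are identities, so these
are used to express the strictness identifications. -/
def SMCData.cHom (C : SMCData) {A B : C.Obj} (h : A = B) : C.Hom A B := by
  cases h; exact C.id A
/-- A differential category: an additive symmetric strict monoidal category with a coalgebra modality and a deriving transformation. -/
structure DiffCat extends SMCData where
  -- strictness coherence: associativity and unit identifications are
  -- (transported) identities compatible with the tensor of morphisms,
  -- and the symmetry satisfies the (strict) hexagon identity
  assoc_natural : ∀ {A₁ A₂ B₁ B₂ C₁ C₂ : Obj} (f : Hom A₁ A₂) (g : Hom B₁ B₂) (h : Hom C₁ C₂),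
    comp (tHom (tHom f g) h) (toSMCData.cHom (tenAssoc A₂ B₂ C₂)) =
      comp (toSMCData.cHom (tenAssoc A₁ B₁ C₁)) (tHom f (tHom g h))
  unit_ten_natural : ∀ {A B : Obj} (f : Hom A B),
    comp (tHom (id unit) f) (toSMCData.cHom (unit_ten B)) =
      comp (toSMCData.cHom (unit_ten A)) f
  ten_unit_natural : ∀ {A B : Obj} (f : Hom A B),
    comp (tHom f (id unit)) (toSMCData.cHom (ten_unit B)) =
      comp (toSMCData.cHom (ten_unit A)) f
  hexagon : ∀ (A B C : Obj),
    comp (toSMCData.cHom (tenAssoc A B C))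
      (comp (tHom (id A) (sw B C))
        (comp (toSMCData.cHom (tenAssoc A C B).symm)
          (comp (tHom (sw A C) (id B)) (toSMCData.cHom (tenAssoc C A B))))) =
      sw (ten A B) C
  -- additive enrichment: hom-sets are commutative monoids and composition
  -- and tensor preserve the additive structure
  add : ∀ {A B : Obj}, Hom A B → Hom A B → Hom A B
  zero : ∀ {A B : Obj}, Hom A B
  add_assoc : ∀ {A B : Obj} (f g h : Hom A B), add (add f g) h = add f (add g h)
  add_comm : ∀ {A B : Obj} (f g : Hom A B), add f g = add g f
  add_zero : ∀ {A B : Obj} (f : Hom A B), add f zero = f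
  comp_add : ∀ {A B C : Obj} (f : Hom A B) (g h : Hom B C),
    comp f (add g h) = add (comp f g) (comp f h)
  add_comp : ∀ {A B C : Obj} (f g : Hom A B) (h : Hom B C),
    comp (add f g) h = add (comp f h) (comp g h)
  comp_zero : ∀ {A B C : Obj} (f : Hom A B), comp f (zero : Hom B C) = zero
  zero_comp : ∀ {A B C : Obj} (f : Hom B C), comp (zero : Hom A B) f = zero
  tHom_add_left : ∀ {A B C D : Obj} (f g : Hom A C) (h : Hom B D),
    tHom (add f g) h = add (tHom f h) (tHom g h)
  tHom_add_right : ∀ {A B C D : Obj} (f : Hom A C) (g h : Hom B D),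
    tHom f (add g h) = add (tHom f g) (tHom f h)
  tHom_zero_left : ∀ {A B C D : Obj} (h : Hom B D),
    tHom (zero : Hom A C) h = zero
  tHom_zero_right : ∀ {A B C D : Obj} (f : Hom A C),
    tHom f (zero : Hom B D) = zero
  -- a coalgebra modality: a comonad (bang, rho, eps) with natural
  -- cocommutative comonoid structure (cmul, cunit) on each bang A,
  -- for which each rho A is a comonoid morphism
  bang : Obj → Obj
  bangMap : ∀ {A B : Obj}, Hom A B → Hom (bang A) (bang B)
  bangMap_id : ∀ (A : Obj), bangMap (id A) = id (bang A)
  bangMap_comp : ∀ {A B C : Obj} (f : Hom A B) (g : Hom B C),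
    bangMap (comp f g) = comp (bangMap f) (bangMap g)
  rho : ∀ (A : Obj), Hom (bang A) (bang (bang A))
  eps : ∀ (A : Obj), Hom (bang A) A
  cmul : ∀ (A : Obj), Hom (bang A) (ten (bang A) (bang A))
  cunit : ∀ (A : Obj), Hom (bang A) unit
  rho_natural : ∀ {A B : Obj} (f : Hom A B),
    comp (bangMap f) (rho B) = comp (rho A) (bangMap (bangMap f))
  eps_natural : ∀ {A B : Obj} (f : Hom A B),
    comp (bangMap f) (eps B) = comp (eps A) f
  cmul_natural : ∀ {A B : Obj} (f : Hom A B),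
    comp (bangMap f) (cmul B) = comp (cmul A) (tHom (bangMap f) (bangMap f))
  cunit_natural : ∀ {A B : Obj} (f : Hom A B),
    comp (bangMap f) (cunit B) = cunit A
  rho_eps : ∀ (A : Obj), comp (rho A) (eps (bang A)) = id (bang A)
  rho_bangMap_eps : ∀ (A : Obj), comp (rho A) (bangMap (eps A)) = id (bang A)
  rho_rho : ∀ (A : Obj), comp (rho A) (rho (bang A)) = comp (rho A) (bangMap (rho A))
  cmul_coassoc : ∀ (A : Obj),
    comp (cmul A) (comp (tHom (cmul A) (id (bang A)))
      (toSMCData.cHom (tenAssoc (bang A) (bang A) (bang A)))) =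
    comp (cmul A) (tHom (id (bang A)) (cmul A))
  cmul_counit_left : ∀ (A : Obj),
    comp (cmul A) (comp (tHom (cunit A) (id (bang A)))
      (toSMCData.cHom (unit_ten (bang A)))) = id (bang A)
  cmul_counit_right : ∀ (A : Obj),
    comp (cmul A) (comp (tHom (id (bang A)) (cunit A))
      (toSMCData.cHom (ten_unit (bang A)))) = id (bang A)
  cmul_cocomm : ∀ (A : Obj), comp (cmul A) (sw (bang A) (bang A)) = cmul A
  rho_cmul : ∀ (A : Obj),
    comp (rho A) (cmul (bang A)) = comp (cmul A) (tHom (rho A) (rho A))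
  rho_cunit : ∀ (A : Obj), comp (rho A) (cunit (bang A)) = cunit A
  -- a deriving transformation [d.1]-[d.5]
  der : ∀ (A : Obj), Hom (ten (bang A) A) (bang A)
  der_natural : ∀ {A B : Obj} (f : Hom A B),
    comp (tHom (bangMap f) f) (der B) = comp (der A) (bangMap f)
  -- [d.1] constant rule
  der_cunit : ∀ (A : Obj), comp (der A) (cunit A) = zero
  -- [d.2] Leibniz rule
  der_cmul : ∀ (A : Obj),
    comp (der A) (cmul A) =
      add
        (comp (tHom (cmul A) (id A))
          (comp (toSMCData.cHom (tenAssoc (bang A) (bang A) A))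
            (comp (tHom (id (bang A)) (sw (bang A) A))
              (comp (toSMCData.cHom (tenAssoc (bang A) A (bang A)).symm)
                (tHom (der A) (id (bang A)))))))
        (comp (tHom (cmul A) (id A))
          (comp (toSMCData.cHom (tenAssoc (bang A) (bang A) A))
            (tHom (id (bang A)) (der A))))
  -- [d.3] linear rule
  der_eps : ∀ (A : Obj),
    comp (der A) (eps A) = comp (tHom (cunit A) (id A)) (toSMCData.cHom (unit_ten A))
  -- [d.4] chain rule
  der_rho : ∀ (A : Obj),
    comp (der A) (rho A) =
      comp (tHom (cmul A) (id A))
        (comp (toSMCData.cHom (tenAssoc (bang A) (bang A) A))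
          (comp (tHom (rho A) (der A)) (der (bang A))))
  -- [d.5] interchange rule
  der_interchange : ∀ (A : Obj),
    comp (tHom (der A) (id A)) (der A) =
      comp (toSMCData.cHom (tenAssoc (bang A) A A))
        (comp (tHom (id (bang A)) (sw A A))
          (comp (toSMCData.cHom (tenAssoc (bang A) A A).symm)
            (comp (tHom (der A) (id A)) (der A))))

def DiffCat.cHom (C : DiffCat) {A B : C.Obj} (h : A = B) : C.Hom A B :=
  C.toSMCData.cHom h

namespace DiffCat

variable (C : DiffCat)

/-- The coderiving transformation d°_A := Δ_A (1 ⊗ ε_A). -/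
def dcirc (A : C.Obj) : C.Hom (C.bang A) (C.ten (C.bang A) A) :=
  C.comp (C.cmul A) (C.tHom (C.id (C.bang A)) (C.eps A))

/-- K_A := d°_A d_A + !(0). -/
def K (A : C.Obj) : C.Hom (C.bang A) (C.bang A) :=
  C.add (C.comp (C.dcirc A) (C.der A)) (C.bangMap (C.zero : C.Hom A A))

/-- J_A := d°_A d_A + 1_{!A}. -/
def J (A : C.Obj) : C.Hom (C.bang A) (C.bang A) :=
  C.add (C.comp (C.dcirc A) (C.der A)) (C.id (C.bang A))

/-- The deriving transformation at the monoidal unit, under the strictness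
identification !R ⊗ R = !R. -/
def dR : C.Hom (C.bang C.unit) (C.bang C.unit) :=
  C.comp (C.cHom (C.ten_unit (C.bang C.unit)).symm) (C.der C.unit)

/-- The coderiving transformation at the monoidal unit, under the strictness
identification !R ⊗ R = !R. -/
def dcircR : C.Hom (C.bang C.unit) (C.bang C.unit) :=
  C.comp (C.dcirc C.unit) (C.cHom (C.ten_unit (C.bang C.unit)))

end DiffCat

namespace SMCData

variable (C : SMCData.{u, v})

theorem cHom_self {A : C.Obj} (h : A = A) : C.cHom h = C.id A := rfl

theorem cHom_comp_cHom {A B D : C.Obj} (h : A = B) (k : B = D) :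
    C.comp (C.cHom h) (C.cHom k) = C.cHom (h.trans k) := by
  subst h k
  exact C.id_comp _

theorem cHom_comp_cHom_assoc {A B D E : C.Obj} (h : A = B) (k : B = D) (f : C.Hom D E) :
    C.comp (C.cHom h) (C.comp (C.cHom k) f) = C.comp (C.cHom (h.trans k)) f := by
  rw [← C.comp_assoc, cHom_comp_cHom]

theorem tHom_id_cHom (A : C.Obj) {B D : C.Obj} (h : B = D) :
    C.tHom (C.id A) (C.cHom h) = C.cHom (congrArg (C.ten A) h) := by
  subst h
  exact C.tHom_id _ _

theorem tHom_cHom_id {A B : C.Obj} (h : A = B) (D : C.Obj) :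
    C.tHom (C.cHom h) (C.id D) = C.cHom (congrArg (fun X => C.ten X D) h) := by
  subst h
  exact C.tHom_id _ _

theorem eq_comp_cHom_symm {A B D : C.Obj} {f : C.Hom A B} {g : C.Hom A D} (h : B = D)
    (w : C.comp f (C.cHom h) = g) : f = C.comp g (C.cHom h.symm) := by
  rw [← w, C.comp_assoc, cHom_comp_cHom, cHom_self, C.comp_id]

theorem eq_cHom_symm_comp {A B D : C.Obj} {f : C.Hom B D} {g : C.Hom A D} (h : A = B)
    (w : C.comp (C.cHom h) f = g) : f = C.comp (C.cHom h.symm) g := by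
  rw [← w, cHom_comp_cHom_assoc, cHom_self, C.id_comp]

end SMCData

namespace DiffCat

variable (C : DiffCat.{u, v})

theorem tHom_unit_right {A B : C.Obj} (f : C.Hom A B) :
    C.tHom f (C.id C.unit) = C.comp (C.toSMCData.cHom (C.ten_unit A))
      (C.comp f (C.toSMCData.cHom (C.ten_unit B).symm)) := by
  rw [C.eq_comp_cHom_symm _ (C.ten_unit_natural f), C.comp_assoc]

theorem tHom_unit_left {A B : C.Obj} (f : C.Hom A B) :
    C.tHom (C.id C.unit) f = C.comp (C.toSMCData.cHom (C.unit_ten A))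
      (C.comp f (C.toSMCData.cHom (C.unit_ten B).symm)) := by
  rw [C.eq_comp_cHom_symm _ (C.unit_ten_natural f), C.comp_assoc]

theorem sw_unit_unit : C.sw C.unit C.unit = C.id (C.ten C.unit C.unit) := by
  have hex := C.hexagon C.unit C.unit C.unit
  have nat := C.sw_natural (C.toSMCData.cHom (C.ten_unit C.unit)) (C.id C.unit)
  rw [SMCData.tHom_cHom_id, SMCData.tHom_id_cHom, ← hex, tHom_unit_left, tHom_unit_right] at nat
  simp only [C.comp_assoc, SMCData.cHom_comp_cHom, SMCData.cHom_comp_cHom_assoc] at nat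
  rw [SMCData.cHom_self C.toSMCData (A := C.ten C.unit C.unit), C.id_comp,
    ← C.comp_assoc (C.sw _ _) (C.sw _ _), C.sw_sw, C.comp_id] at nat
  rw [C.eq_cHom_symm_comp _ nat, SMCData.cHom_comp_cHom_assoc, SMCData.cHom_self, C.id_comp]

theorem tHom_comp_id {A B D : C.Obj} (f : C.Hom A B) (g : C.Hom B D) (E : C.Obj) :
    C.tHom (C.comp f g) (C.id E) = C.comp (C.tHom f (C.id E)) (C.tHom g (C.id E)) := by
  rw [← C.tHom_comp, C.id_comp]

theorem tHom_id_comp (E : C.Obj) {A B D : C.Obj} (f : C.Hom A B) (g : C.Hom B D) :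
    C.tHom (C.id E) (C.comp f g) = C.comp (C.tHom (C.id E) f) (C.tHom (C.id E) g) := by
  rw [← C.tHom_comp, C.id_comp]

theorem cHom_symm_assoc_natural {A₁ A₂ B₁ B₂ D₁ D₂ : C.Obj} (f : C.Hom A₁ A₂)
    (g : C.Hom B₁ B₂) (h : C.Hom D₁ D₂) :
    C.comp (C.toSMCData.cHom (C.tenAssoc A₁ B₁ D₁).symm) (C.tHom (C.tHom f g) h) =
      C.comp (C.tHom f (C.tHom g h)) (C.toSMCData.cHom (C.tenAssoc A₂ B₂ D₂).symm) := by
  rw [C.eq_comp_cHom_symm _ (C.assoc_natural f g h), C.comp_assoc,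
    SMCData.cHom_comp_cHom_assoc, SMCData.cHom_self, C.id_comp]

/-- The Leibniz rule for the coderiving transformation. -/
theorem der_dcirc (A : C.Obj) :
    C.comp (C.der A) (C.dcirc A) =
      C.add
        (C.comp (C.tHom (C.dcirc A) (C.id A))
          (C.comp (C.toSMCData.cHom (C.tenAssoc (C.bang A) A A))
            (C.comp (C.tHom (C.id (C.bang A)) (C.sw A A))
              (C.comp (C.toSMCData.cHom (C.tenAssoc (C.bang A) A A).symm)
                (C.tHom (C.der A) (C.id A))))))
        (C.id (C.ten (C.bang A) A)) := by
  rw [dcirc, ← C.comp_assoc, C.der_cmul, C.add_comp]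
  congr 1
  · have h : C.comp (C.tHom (C.der A) (C.id (C.bang A))) (C.tHom (C.id (C.bang A)) (C.eps A)) =
        C.comp (C.tHom (C.tHom (C.id (C.bang A)) (C.id A)) (C.eps A))
          (C.tHom (C.der A) (C.id A)) := by
      rw [← C.tHom_comp, ← C.tHom_comp, C.tHom_id, C.id_comp, C.id_comp, C.comp_id, C.comp_id]
    simp only [C.comp_assoc]
    rw [h, ← C.comp_assoc (C.toSMCData.cHom (C.tenAssoc (C.bang A) A (C.bang A)).symm),
      cHom_symm_assoc_natural, C.comp_assoc, ← C.comp_assoc (C.tHom _ (C.sw _ _)),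
      ← tHom_id_comp, ← C.sw_natural, tHom_id_comp, C.comp_assoc,
      ← C.comp_assoc (C.toSMCData.cHom _), ← C.assoc_natural, tHom_comp_id]
    simp only [C.comp_assoc]
  · simp only [C.comp_assoc]
    rw [← tHom_id_comp, C.der_eps, tHom_id_comp, ← C.comp_assoc (C.toSMCData.cHom _),
      ← C.assoc_natural, C.comp_assoc, SMCData.tHom_id_cHom, SMCData.cHom_comp_cHom,
      ← C.tHom_cHom_id (C.ten_unit (C.bang A)), ← tHom_comp_id, ← tHom_comp_id,
      C.cmul_counit_right, C.tHom_id]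

theorem dcircR_comp_dR :
    C.comp C.dcircR C.dR = C.comp (C.dcirc C.unit) (C.der C.unit) := by
  rw [dcircR, dR, C.comp_assoc, cHom, cHom, SMCData.cHom_comp_cHom_assoc, SMCData.cHom_self,
    C.id_comp]

theorem dR_comp_dcircR : C.comp C.dR C.dcircR = C.J C.unit := by
  have h : C.comp C.dR C.dcircR =
      C.comp (C.toSMCData.cHom (C.ten_unit (C.bang C.unit)).symm)
        (C.comp (C.comp (C.der C.unit) (C.dcirc C.unit))
          (C.toSMCData.cHom (C.ten_unit (C.bang C.unit)))) := by
    simp only [dR, dcircR, cHom, C.comp_assoc]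
  rw [h, der_dcirc, sw_unit_unit, C.tHom_id, C.id_comp, SMCData.cHom_comp_cHom_assoc,
    SMCData.cHom_self, C.id_comp, ← tHom_comp_id, tHom_unit_right, C.add_comp, C.comp_add,
    C.id_comp]
  simp only [C.comp_assoc, SMCData.cHom_comp_cHom, SMCData.cHom_comp_cHom_assoc,
    SMCData.cHom_self, C.comp_id, C.id_comp]
  rfl

theorem bangMap_zero_comp_dcirc (A B : C.Obj) :
    C.comp (C.bangMap (C.zero : C.Hom A B)) (C.dcirc B) = C.zero := by
  rw [dcirc, ← C.comp_assoc, C.cmul_natural, C.comp_assoc, ← C.tHom_comp, C.eps_natural,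
    C.comp_zero, C.tHom_zero_right, C.comp_zero]

theorem der_comp_bangMap_zero (A B : C.Obj) :
    C.comp (C.der A) (C.bangMap (C.zero : C.Hom A B)) = C.zero := by
  rw [← C.der_natural, C.tHom_zero_right, C.zero_comp]

end DiffCat

/-- Lemma: at the monoidal unit, K_R d°_R = d°_R J_R, d_R K_R = J_R d_R and
d_R d°_R = J_R (using the strictness identifications). -/
theorem statement2 (C : DiffCat) :
    (C.comp (C.K C.unit) C.dcircR = C.comp C.dcircR (C.J C.unit)) ∧
    (C.comp C.dR (C.K C.unit) = C.comp (C.J C.unit) C.dR) ∧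
    (C.comp C.dR C.dcircR = C.J C.unit) := by
  refine ⟨?_, ?_, C.dR_comp_dcircR⟩
  · rw [DiffCat.K, C.add_comp, ← C.dcircR_comp_dR, C.comp_assoc, C.dR_comp_dcircR,
      DiffCat.dcircR, ← C.comp_assoc (C.bangMap _), C.bangMap_zero_comp_dcirc, C.zero_comp,
      C.add_zero]
  · rw [DiffCat.K, C.comp_add, ← C.dcircR_comp_dR, ← C.comp_assoc, C.dR_comp_dcircR]
    conv_lhs => rw [DiffCat.dR, C.comp_assoc (C.cHom _) (C.der _) (C.bangMap _)]
    rw [C.der_comp_bangMap_zero, C.comp_zero, C.add_zero, DiffCat.dR]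
end

section
/- In a differential category with antiderivatives, J is also a natural isomorphism and, for every object A, the antiderivative integral transformation satisfies s_A = d°_A (J_A⁻¹ ⊗ 1_A), and moreover the Second Fundamental Theorem of Calculus holds: s_A d_A + !(0) = 1_{!A}. -/
universe u v

namespace DiffCat

local notation:80 f:81 "⊳" g:80 => SMCData.comp _ f g
local notation:85 f:86 "⊠" g:85 => SMCData.tHom _ f g

variable {C : DiffCat}

/-! ### Transported identities and the interchange law -/

theorem cHom_symm_comp {A B : C.Obj} (h : A = B) :
    C.toSMCData.cHom h.symm ⊳ C.toSMCData.cHom h = C.id B := by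
  subst h; exact C.id_comp _

theorem cHom_comp_symm {A B : C.Obj} (h : A = B) :
    C.toSMCData.cHom h ⊳ C.toSMCData.cHom h.symm = C.id A := by
  subst h; exact C.id_comp _

theorem cHom_comp_cHom {A B D : C.Obj} (h : A = B) (k : B = D) :
    C.toSMCData.cHom h ⊳ C.toSMCData.cHom k = C.toSMCData.cHom (h.trans k) := by
  subst h; exact C.id_comp _

theorem id_tHom_cHom (D : C.Obj) {A B : C.Obj} (h : A = B) :
    C.id D ⊠ C.toSMCData.cHom h = C.toSMCData.cHom (congrArg (C.ten D) h) := by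
  subst h; exact C.tHom_id _ _

theorem cHom_tHom_id (D : C.Obj) {A B : C.Obj} (h : A = B) :
    C.toSMCData.cHom h ⊠ C.id D = C.toSMCData.cHom (congrArg (C.ten · D) h) := by
  subst h; exact C.tHom_id _ _

/-- The triangle identity. -/
theorem tenAssoc_comp_unit_ten (A B : C.Obj) :
    C.toSMCData.cHom (C.tenAssoc A C.unit B) ⊳ (C.id A ⊠ C.toSMCData.cHom (C.unit_ten B)) =
      C.toSMCData.cHom (C.ten_unit A) ⊠ C.id B := by
  rw [id_tHom_cHom, cHom_tHom_id, cHom_comp_cHom]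

theorem tHom_tHom {A₁ A₂ A₃ B₁ B₂ B₃ : C.Obj} (f : C.Hom A₁ A₂) (f' : C.Hom B₁ B₂)
    (g : C.Hom A₂ A₃) (g' : C.Hom B₂ B₃) :
    (f ⊠ f') ⊳ (g ⊠ g') = (f ⊳ g) ⊠ (f' ⊳ g') :=
  (C.tHom_comp f g f' g').symm

theorem tHom_tHom_assoc {A₁ A₂ A₃ B₁ B₂ B₃ D : C.Obj} (f : C.Hom A₁ A₂) (f' : C.Hom B₁ B₂)
    (g : C.Hom A₂ A₃) (g' : C.Hom B₂ B₃) (k : C.Hom (C.ten A₃ B₃) D) :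
    (f ⊠ f') ⊳ (g ⊠ g') ⊳ k = ((f ⊳ g) ⊠ (f' ⊳ g')) ⊳ k := by
  rw [← C.comp_assoc, tHom_tHom]

theorem assoc_natural_assoc {A₁ A₂ B₁ B₂ D₁ D₂ E : C.Obj} (f : C.Hom A₁ A₂) (g : C.Hom B₁ B₂)
    (h : C.Hom D₁ D₂) (k : C.Hom (C.ten A₂ (C.ten B₂ D₂)) E) :
    ((f ⊠ g) ⊠ h) ⊳ C.toSMCData.cHom (C.tenAssoc A₂ B₂ D₂) ⊳ k =
      C.toSMCData.cHom (C.tenAssoc A₁ B₁ D₁) ⊳ (f ⊠ (g ⊠ h)) ⊳ k := by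
  rw [← C.comp_assoc, C.assoc_natural, C.comp_assoc]

theorem assoc_symm_natural {A₁ A₂ B₁ B₂ D₁ D₂ : C.Obj} (f : C.Hom A₁ A₂) (g : C.Hom B₁ B₂)
    (h : C.Hom D₁ D₂) :
    (f ⊠ (g ⊠ h)) ⊳ C.toSMCData.cHom (C.tenAssoc A₂ B₂ D₂).symm =
      C.toSMCData.cHom (C.tenAssoc A₁ B₁ D₁).symm ⊳ ((f ⊠ g) ⊠ h) := by
  rw [← C.comp_id (C.toSMCData.cHom (C.tenAssoc A₁ B₁ D₁).symm ⊳ ((f ⊠ g) ⊠ h)),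
    ← cHom_comp_symm (C.tenAssoc A₂ B₂ D₂), C.comp_assoc, assoc_natural_assoc, ← C.comp_assoc,
    cHom_symm_comp, C.id_comp]

/-! ### The swap of the last two factors -/

/-- `1 ⊗ σ` on a left-bracketed triple tensor product. -/
def swapRight (X Y Z : C.Obj) : C.Hom (C.ten (C.ten X Y) Z) (C.ten (C.ten X Z) Y) :=
  C.toSMCData.cHom (C.tenAssoc X Y Z) ⊳ (C.id X ⊠ C.sw Y Z) ⊳
    C.toSMCData.cHom (C.tenAssoc X Z Y).symm

theorem swapRight_natural {X X' Y Y' Z Z' : C.Obj} (f : C.Hom X X') (g : C.Hom Y Y')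
    (h : C.Hom Z Z') :
    ((f ⊠ g) ⊠ h) ⊳ swapRight X' Y' Z' = swapRight X Y Z ⊳ ((f ⊠ h) ⊠ g) := by
  simp only [swapRight, C.comp_assoc]
  rw [assoc_natural_assoc, ← assoc_symm_natural, tHom_tHom_assoc, tHom_tHom_assoc,
    C.sw_natural, C.comp_id, C.id_comp]

/-! ### The coderiving transformation -/

theorem dcirc_natural {A B : C.Obj} (f : C.Hom A B) :
    C.bangMap f ⊳ C.dcirc B = C.dcirc A ⊳ (C.bangMap f ⊠ f) := by
  simp only [dcirc]
  rw [← C.comp_assoc, C.cmul_natural, C.comp_assoc, C.comp_assoc, tHom_tHom, tHom_tHom,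
    C.eps_natural, C.comp_id, C.id_comp]

theorem dcirc_cunit (A : C.Obj) :
    C.dcirc A ⊳ (C.cunit A ⊠ C.id A) ⊳ C.toSMCData.cHom (C.unit_ten A) = C.eps A := by
  rw [dcirc, C.comp_assoc, tHom_tHom_assoc, C.id_comp, C.comp_id]
  have h : C.cunit A ⊠ C.eps A = (C.cunit A ⊠ C.id (C.bang A)) ⊳ (C.id C.unit ⊠ C.eps A) := by
    rw [tHom_tHom, C.id_comp, C.comp_id]
  rw [h, C.comp_assoc, C.unit_ten_natural, ← C.comp_assoc (C.cunit A ⊠ _), ← C.comp_assoc,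
    C.cmul_counit_left, C.id_comp]

theorem dcirc_cmul (A : C.Obj) :
    C.dcirc A ⊳ (C.cmul A ⊠ C.id A) ⊳ C.toSMCData.cHom (C.tenAssoc _ _ _) =
      C.cmul A ⊳ (C.id _ ⊠ C.dcirc A) := by
  have h : C.cmul A ⊠ C.eps A =
      (C.cmul A ⊠ C.id (C.bang A)) ⊳ ((C.id (C.bang A) ⊠ C.id (C.bang A)) ⊠ C.eps A) := by
    rw [tHom_tHom, C.id_comp, C.tHom_id, C.comp_id]
  have h' : C.id (C.bang A) ⊠ C.dcirc A =
      (C.id (C.bang A) ⊠ C.cmul A) ⊳ (C.id (C.bang A) ⊠ (C.id (C.bang A) ⊠ C.eps A)) := by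
    rw [tHom_tHom, C.id_comp]; rfl
  rw [h', dcirc, C.comp_assoc, tHom_tHom_assoc, C.id_comp, C.comp_id, h, C.comp_assoc,
    C.assoc_natural, ← C.comp_assoc (C.cmul A ⊠ _), ← C.comp_assoc, C.cmul_coassoc, C.comp_assoc]

theorem dcirc_dcirc_swapRight (A : C.Obj) :
    C.dcirc A ⊳ (C.dcirc A ⊠ C.id A) ⊳ swapRight _ _ _ =
      C.dcirc A ⊳ (C.dcirc A ⊠ C.id A) := by
  have key : C.dcirc A ⊳ (C.dcirc A ⊠ C.id A) ⊳ C.toSMCData.cHom (C.tenAssoc _ _ _) =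
      C.cmul A ⊳ (C.id _ ⊠ (C.cmul A ⊳ (C.eps A ⊠ C.eps A))) := by
    have h : C.dcirc A ⊠ C.id A =
        (C.cmul A ⊠ C.id A) ⊳ ((C.id (C.bang A) ⊠ C.eps A) ⊠ C.id A) := by
      rw [tHom_tHom, C.id_comp]; rfl
    rw [h, C.comp_assoc, C.assoc_natural, ← C.comp_assoc (C.cmul A ⊠ _), ← C.comp_assoc,
      dcirc_cmul, C.comp_assoc, tHom_tHom, C.id_comp, dcirc, C.comp_assoc, tHom_tHom,
      C.id_comp, C.comp_id]
  have hsw : (C.cmul A ⊳ (C.eps A ⊠ C.eps A)) ⊳ C.sw A A = C.cmul A ⊳ (C.eps A ⊠ C.eps A) := by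
    rw [C.comp_assoc, C.sw_natural, ← C.comp_assoc, C.cmul_cocomm]
  calc C.dcirc A ⊳ (C.dcirc A ⊠ C.id A) ⊳ swapRight _ _ _
      = (C.dcirc A ⊳ (C.dcirc A ⊠ C.id A) ⊳ C.toSMCData.cHom (C.tenAssoc _ _ _)) ⊳
          (C.id _ ⊠ C.sw A A) ⊳ C.toSMCData.cHom (C.tenAssoc _ _ _).symm := by
        simp only [swapRight, C.comp_assoc]
    _ = (C.dcirc A ⊳ (C.dcirc A ⊠ C.id A) ⊳ C.toSMCData.cHom (C.tenAssoc _ _ _)) ⊳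
          C.toSMCData.cHom (C.tenAssoc _ _ _).symm := by
        rw [key, C.comp_assoc, tHom_tHom_assoc, C.id_comp, hsw, C.comp_assoc]
    _ = C.dcirc A ⊳ (C.dcirc A ⊠ C.id A) := by
        rw [C.comp_assoc, C.comp_assoc, cHom_comp_symm, C.comp_id]

/-- The Leibniz rule for the deriving and coderiving transformations. -/
theorem der_dcirc_s6 (A : C.Obj) :
    C.der A ⊳ C.dcirc A =
      C.add ((C.dcirc A ⊠ C.id A) ⊳ swapRight _ _ _ ⊳ (C.der A ⊠ C.id A)) (C.id _) := by
  have h₁ : ((C.cmul A ⊠ C.id A) ⊳ swapRight _ _ _ ⊳ (C.der A ⊠ C.id (C.bang A))) ⊳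
      (C.id _ ⊠ C.eps A) =
      (C.dcirc A ⊠ C.id A) ⊳ swapRight _ _ _ ⊳ (C.der A ⊠ C.id A) := by
    have h : C.dcirc A ⊠ C.id A =
        (C.cmul A ⊠ C.id A) ⊳ ((C.id (C.bang A) ⊠ C.eps A) ⊠ C.id A) := by
      rw [tHom_tHom, C.id_comp]; rfl
    rw [h, C.comp_assoc, C.comp_assoc, C.comp_assoc, tHom_tHom,
      ← C.comp_assoc ((C.id _ ⊠ C.eps A) ⊠ C.id A), swapRight_natural, C.comp_assoc, tHom_tHom,
      C.tHom_id, C.id_comp, C.id_comp, C.comp_id, C.comp_id]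
  have h₂ : ((C.cmul A ⊠ C.id A) ⊳ C.toSMCData.cHom (C.tenAssoc _ _ _) ⊳
      (C.id (C.bang A) ⊠ C.der A)) ⊳ (C.id _ ⊠ C.eps A) = C.id _ := by
    have h : C.id (C.bang A) ⊠ (C.der A ⊳ C.eps A) =
        (C.id (C.bang A) ⊠ (C.cunit A ⊠ C.id A)) ⊳
          (C.id (C.bang A) ⊠ C.toSMCData.cHom (C.unit_ten A)) := by
      rw [tHom_tHom, C.id_comp, C.der_eps]
    rw [C.comp_assoc, C.comp_assoc, tHom_tHom, C.id_comp, h, ← assoc_natural_assoc,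
      tenAssoc_comp_unit_ten, tHom_tHom, tHom_tHom, C.cmul_counit_right, C.id_comp, C.id_comp,
      C.tHom_id]
  have hL := C.der_cmul A
  rw [dcirc, ← C.comp_assoc, hL, C.add_comp, h₂, ← dcirc, ← h₁]
  simp only [swapRight, C.comp_assoc]

theorem der_bangMap_zero (A : C.Obj) : C.der A ⊳ C.bangMap (C.zero : C.Hom A A) = C.zero := by
  rw [← C.der_natural, C.tHom_zero_right, C.zero_comp]

theorem bangMap_zero_dcirc (A : C.Obj) : C.bangMap (C.zero : C.Hom A A) ⊳ C.dcirc A = C.zero := by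
  rw [dcirc_natural, C.tHom_zero_right, C.comp_zero]

/-! ### The derivation induced by an endomorphism -/

/-- The endomorphism `d° (1 ⊗ h) d` of `!A`. -/
def inducedDer {A : C.Obj} (h : C.Hom A A) : C.Hom (C.bang A) (C.bang A) :=
  C.dcirc A ⊳ (C.id _ ⊠ h) ⊳ C.der A

theorem inducedDer_id (A : C.Obj) : inducedDer (C.id A) = C.dcirc A ⊳ C.der A := by
  rw [inducedDer, C.tHom_id, C.id_comp]

theorem inducedDer_dcirc {A : C.Obj} (h : C.Hom A A) :
    inducedDer h ⊳ C.dcirc A =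
      C.add (C.dcirc A ⊳ (inducedDer h ⊠ C.id A)) (C.dcirc A ⊳ (C.id _ ⊠ h)) := by
  have h₁ : (C.id _ ⊠ h) ⊳ (C.dcirc A ⊠ C.id A) ⊳ swapRight _ _ _ =
      (C.dcirc A ⊠ C.id A) ⊳ swapRight _ _ _ ⊳ ((C.id _ ⊠ h) ⊠ C.id A) := by
    rw [← swapRight_natural, tHom_tHom_assoc, tHom_tHom_assoc, C.tHom_id, C.id_comp, C.id_comp,
      C.comp_id, C.comp_id]
  have h₂ : C.dcirc A ⊳ (C.id _ ⊠ h) ⊳ (C.dcirc A ⊠ C.id A) ⊳ swapRight _ _ _ ⊳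
      (C.der A ⊠ C.id A) = C.dcirc A ⊳ (inducedDer h ⊠ C.id A) := by
    rw [← C.comp_assoc (C.dcirc A ⊠ _), ← C.comp_assoc (C.id _ ⊠ h), h₁, C.comp_assoc,
      C.comp_assoc, ← C.comp_assoc (C.dcirc A ⊠ _), ← C.comp_assoc, dcirc_dcirc_swapRight,
      C.comp_assoc, tHom_tHom, tHom_tHom, C.id_comp, C.id_comp]
    rfl
  rw [← h₂, inducedDer, C.comp_assoc, C.comp_assoc, der_dcirc_s6, C.comp_add, C.comp_id, C.comp_add]

theorem dcirc_der_dcirc (A : C.Obj) :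
    (C.dcirc A ⊳ C.der A) ⊳ C.dcirc A = C.dcirc A ⊳ (C.J A ⊠ C.id A) := by
  rw [← inducedDer_id, inducedDer_dcirc, inducedDer_id, J, C.tHom_add_left, C.comp_add]

theorem der_dcirc_der (A : C.Obj) :
    C.der A ⊳ C.dcirc A ⊳ C.der A = (C.J A ⊠ C.id A) ⊳ C.der A := by
  have h : swapRight _ _ _ ⊳ (C.der A ⊠ C.id A) ⊳ C.der A = (C.der A ⊠ C.id A) ⊳ C.der A := by
    simp only [swapRight, C.comp_assoc]
    exact (C.der_interchange A).symm
  rw [← C.comp_assoc, der_dcirc_s6, C.add_comp, C.comp_assoc, C.comp_assoc, h, tHom_tHom_assoc, J,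
    C.tHom_add_left, C.add_comp, C.id_comp, C.tHom_id]

theorem K_dcirc (A : C.Obj) : C.K A ⊳ C.dcirc A = C.dcirc A ⊳ (C.J A ⊠ C.id A) := by
  rw [K, C.add_comp, bangMap_zero_dcirc, C.add_zero, dcirc_der_dcirc]

theorem K_bangMap_zero (A : C.Obj) :
    C.K A ⊳ C.bangMap (C.zero : C.Hom A A) = C.bangMap (C.zero : C.Hom A A) := by
  rw [K, C.add_comp, C.comp_assoc, der_bangMap_zero, C.comp_zero, C.add_comm, C.add_zero,
    ← C.bangMap_comp, C.comp_zero]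

theorem inducedDer_comm_K {A : C.Obj} (h : C.Hom A A) :
    inducedDer h ⊳ C.K A = C.K A ⊳ inducedDer h := by
  have h₁ : inducedDer h ⊳ C.K A = C.dcirc A ⊳ (C.J A ⊠ h) ⊳ C.der A := by
    rw [inducedDer, K, C.comp_add, C.comp_assoc, C.comp_assoc, C.comp_assoc, C.comp_assoc,
      der_bangMap_zero, C.comp_zero, C.comp_zero, C.add_zero, der_dcirc_der, tHom_tHom_assoc,
      C.id_comp, C.comp_id]
  rw [h₁, inducedDer, ← C.comp_assoc (C.K A), K_dcirc, C.comp_assoc, tHom_tHom_assoc, C.id_comp,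
    C.comp_id]

/-! ### Naturality of `J` and compatibility with the comonad -/

theorem J_natural {A B : C.Obj} (f : C.Hom A B) :
    C.J A ⊳ C.bangMap f = C.bangMap f ⊳ C.J B := by
  rw [J, J, C.add_comp, C.comp_add, ← C.comp_assoc (C.bangMap f), dcirc_natural, C.comp_assoc,
    C.comp_assoc, C.der_natural, C.id_comp, C.comp_id]

theorem dcirc_der_eps (A : C.Obj) : (C.dcirc A ⊳ C.der A) ⊳ C.eps A = C.eps A := by
  rw [C.comp_assoc, C.der_eps, dcirc_cunit]

theorem dcirc_der_cunit (A : C.Obj) : (C.dcirc A ⊳ C.der A) ⊳ C.cunit A = C.zero := by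
  rw [C.comp_assoc, C.der_cunit, C.comp_zero]

theorem rho_dcirc (A : C.Obj) :
    C.rho A ⊳ C.dcirc (C.bang A) = C.cmul A ⊳ (C.rho A ⊠ C.id (C.bang A)) := by
  rw [dcirc, ← C.comp_assoc, C.rho_cmul, C.comp_assoc, tHom_tHom, C.rho_eps, C.comp_id]

theorem dcirc_der_rho (A : C.Obj) :
    (C.dcirc A ⊳ C.der A) ⊳ C.rho A = C.rho A ⊳ inducedDer (C.dcirc A ⊳ C.der A) := by
  rw [inducedDer, ← C.comp_assoc (C.rho A), rho_dcirc, C.comp_assoc, C.comp_assoc, C.der_rho,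
    tHom_tHom_assoc, C.id_comp, C.comp_id, ← C.comp_assoc (C.cmul A ⊠ _), ← C.comp_assoc,
    dcirc_cmul, C.comp_assoc, tHom_tHom_assoc, C.id_comp]

theorem inducedDer_bangMap_eps (A : C.Obj) :
    inducedDer (C.dcirc A ⊳ C.der A) ⊳ C.bangMap (C.eps A) =
      C.bangMap (C.eps A) ⊳ C.dcirc A ⊳ C.der A := by
  rw [inducedDer, C.comp_assoc, C.comp_assoc, ← C.der_natural, tHom_tHom_assoc, C.id_comp,
    dcirc_der_eps, ← C.comp_assoc (C.bangMap _), dcirc_natural, C.comp_assoc]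

/-! ### The inverse of `J` -/

/-- The inverse of `J_A` built from an inverse `k` of `K_{!A}`, namely
`ρ k d° (!ε ⊗ e)`; on functions it is `f ↦ ∫₀¹ f (t x) dt`. -/
def jInv {A : C.Obj} (k : C.Hom (C.bang (C.bang A)) (C.bang (C.bang A))) :
    C.Hom (C.bang A) (C.bang A) :=
  C.rho A ⊳ k ⊳ C.dcirc (C.bang A) ⊳ (C.bangMap (C.eps A) ⊠ C.cunit A) ⊳
    C.toSMCData.cHom (C.ten_unit (C.bang A))

theorem tHom_cunit_comp {A B D E : C.Obj} (f : C.Hom A B) (g : C.Hom E C.unit) (l : C.Hom B D) :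
    (f ⊠ g) ⊳ C.toSMCData.cHom (C.ten_unit B) ⊳ l =
      ((f ⊳ l) ⊠ g) ⊳ C.toSMCData.cHom (C.ten_unit D) := by
  rw [← C.ten_unit_natural, tHom_tHom_assoc, C.comp_id]

theorem jInv_comp_J {A : C.Obj} {k : C.Hom (C.bang (C.bang A)) (C.bang (C.bang A))}
    (hk : k ⊳ C.K (C.bang A) = C.id _) : jInv k ⊳ C.J A = C.id _ := by
  have h₁ : (C.bangMap (C.eps A) ⊳ C.J A) ⊠ C.cunit A =
      (C.J (C.bang A) ⊠ C.id (C.bang A)) ⊳ (C.bangMap (C.eps A) ⊠ C.cunit A) := by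
    rw [tHom_tHom, J_natural, C.id_comp]
  have h₂ : k ⊳ C.dcirc (C.bang A) ⊳ (C.J (C.bang A) ⊠ C.id (C.bang A)) =
      C.dcirc (C.bang A) := by
    rw [← K_dcirc, ← C.comp_assoc, hk, C.id_comp]
  rw [jInv, C.comp_assoc, C.comp_assoc, C.comp_assoc, C.comp_assoc, tHom_cunit_comp, h₁,
    C.comp_assoc, ← C.comp_assoc (C.dcirc _), ← C.comp_assoc k, h₂, ← C.comp_assoc, rho_dcirc,
    C.comp_assoc, tHom_tHom_assoc, C.rho_bangMap_eps, C.id_comp, C.cmul_counit_right]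

theorem dcirc_der_comp_jInv {A : C.Obj} {k : C.Hom (C.bang (C.bang A)) (C.bang (C.bang A))}
    (hk₁ : C.K (C.bang A) ⊳ k = C.id _) (hk₂ : k ⊳ C.K (C.bang A) = C.id _) :
    (C.dcirc A ⊳ C.der A) ⊳ jInv k = jInv k ⊳ C.dcirc A ⊳ C.der A := by
  have hcomm : inducedDer (C.dcirc A ⊳ C.der A) ⊳ k =
      k ⊳ inducedDer (C.dcirc A ⊳ C.der A) := by
    rw [← C.id_comp (inducedDer _ ⊳ k), ← hk₂, C.comp_assoc, ← C.comp_assoc (C.K _),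
      ← inducedDer_comm_K, C.comp_assoc, hk₁, C.comp_id]
  have h : inducedDer (C.dcirc A ⊳ C.der A) ⊳ C.dcirc (C.bang A) ⊳
      (C.bangMap (C.eps A) ⊠ C.cunit A) =
      C.dcirc (C.bang A) ⊳ ((C.bangMap (C.eps A) ⊳ C.dcirc A ⊳ C.der A) ⊠ C.cunit A) := by
    rw [← C.comp_assoc, inducedDer_dcirc, C.add_comp, C.comp_assoc, C.comp_assoc, tHom_tHom,
      tHom_tHom, dcirc_der_cunit, C.tHom_zero_right, C.comp_zero, C.add_zero,
      inducedDer_bangMap_eps, C.id_comp]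
  calc (C.dcirc A ⊳ C.der A) ⊳ jInv k
      = C.rho A ⊳ (inducedDer (C.dcirc A ⊳ C.der A) ⊳ k) ⊳ C.dcirc (C.bang A) ⊳
          (C.bangMap (C.eps A) ⊠ C.cunit A) ⊳ C.toSMCData.cHom (C.ten_unit (C.bang A)) := by
        rw [jInv, ← C.comp_assoc, dcirc_der_rho, C.comp_assoc, C.comp_assoc (inducedDer _)]
    _ = C.rho A ⊳ k ⊳ (inducedDer (C.dcirc A ⊳ C.der A) ⊳ C.dcirc (C.bang A) ⊳
          (C.bangMap (C.eps A) ⊠ C.cunit A)) ⊳ C.toSMCData.cHom (C.ten_unit (C.bang A)) := by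
        rw [hcomm]; simp only [C.comp_assoc]
    _ = jInv k ⊳ C.dcirc A ⊳ C.der A := by
        rw [h, jInv, C.comp_assoc, C.comp_assoc, C.comp_assoc, C.comp_assoc, C.comp_assoc,
          tHom_cunit_comp]

theorem J_comp_jInv {A : C.Obj} {k : C.Hom (C.bang (C.bang A)) (C.bang (C.bang A))}
    (hk₁ : C.K (C.bang A) ⊳ k = C.id _) (hk₂ : k ⊳ C.K (C.bang A) = C.id _) :
    C.J A ⊳ jInv k = C.id _ := by
  rw [← jInv_comp_J hk₂, J, C.add_comp, C.comp_add, dcirc_der_comp_jInv hk₁ hk₂, C.id_comp,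
    C.comp_id]

end DiffCat

/-- In a differential category with antiderivatives (K a natural isomorphism,
with inverse Kinv), J is also a natural isomorphism, the antiderivative
integral transformation s_A := K_A⁻¹ d°_A satisfies s_A = d°_A (J_A⁻¹ ⊗ 1_A),
and the Second Fundamental Theorem of Calculus s_A d_A + !(0) = 1 holds. -/
theorem statement6 (C : DiffCat)
    (Kinv : ∀ A : C.Obj, C.Hom (C.bang A) (C.bang A))
    (hK1 : ∀ A : C.Obj, C.comp (C.K A) (Kinv A) = C.id (C.bang A))
    (hK2 : ∀ A : C.Obj, C.comp (Kinv A) (C.K A) = C.id (C.bang A)) :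
    (∀ A : C.Obj, ∃ g : C.Hom (C.bang A) (C.bang A),
        C.comp (C.J A) g = C.id (C.bang A) ∧ C.comp g (C.J A) = C.id (C.bang A)) ∧
    (∀ (A : C.Obj) (Jinv : C.Hom (C.bang A) (C.bang A)),
        C.comp (C.J A) Jinv = C.id (C.bang A) → C.comp Jinv (C.J A) = C.id (C.bang A) →
          C.comp (Kinv A) (C.dcirc A) = C.comp (C.dcirc A) (C.tHom Jinv (C.id A))) ∧
    (∀ A : C.Obj,
        C.add (C.comp (C.comp (Kinv A) (C.dcirc A)) (C.der A))
            (C.bangMap (C.zero : C.Hom A A)) =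
          C.id (C.bang A)) := by
  refine ⟨fun A => ⟨DiffCat.jInv (Kinv (C.bang A)), DiffCat.J_comp_jInv (hK1 _) (hK2 _),
    DiffCat.jInv_comp_J (hK2 _)⟩, fun A Jinv hJ _ => ?_, fun A => ?_⟩
  · rw [← C.comp_id (C.comp (Kinv A) (C.dcirc A)), ← C.tHom_id, ← hJ, ← C.id_comp (C.id A),
      C.tHom_comp, C.comp_assoc, ← C.comp_assoc (C.dcirc A), ← DiffCat.K_dcirc, C.comp_assoc,
      ← C.comp_assoc (Kinv A), hK2, C.id_comp, C.id_comp]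
  · have h : C.comp (Kinv A) (C.bangMap (C.zero : C.Hom A A)) = C.bangMap C.zero := by
      rw [← DiffCat.K_bangMap_zero, ← C.comp_assoc, hK2, C.id_comp, DiffCat.K_bangMap_zero]
    rw [C.comp_assoc, ← h, ← C.comp_add]
    exact hK2 A
end
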